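/- For every even integer s with 0 ≤ s ≤ N, f(s) equals the minimum even integer r for which there exists a set R of exactly r lines of PG(2,q) with |𝒫ᵒ(R)| = s. -/

import Mathlib

open scoped BigOperators

/-- Points (and, by self-duality of homogeneous coordinates, lines) of the
Desarguesian projective plane `PG(2,q)` over the field `F`. -/
abbrev PG (F : Type*) [Field F] := Projectivization F (Fin 3 → F)

/-- Incidence between a point and a line (the line being given by its dual
homogeneous coordinates): the dot product of representatives vanishes.
This does not depend on the choice of representatives. -/
def Incid {F : Type*} [Field F] (p l : PG F) : Prop :=
  ∑ i, p.rep i * l.rep i = 0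

/-- `𝒫ᵒ(R)`: points incident with an odd number of lines of `R`. -/
def Podd (F : Type*) [Field F] (R : Set (PG F)) : Set (PG F) :=
  {p | Odd {l ∈ R | Incid p l}.ncard}

/-- `𝒫ᵉ(R)`: points incident with an even number of lines of `R`. -/
def Peven (F : Type*) [Field F] (R : Set (PG F)) : Set (PG F) :=
  {p | Even {l ∈ R | Incid p l}.ncard}

/-- `ℒᵒ(S)`: lines meeting `S` in an odd number of points. -/
def Lodd (F : Type*) [Field F] (S : Set (PG F)) : Set (PG F) :=
  {l | Odd {p ∈ S | Incid p l}.ncard}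

/-- `ℒᵉ(S)`: lines meeting `S` in an even number of points. -/
def Leven (F : Type*) [Field F] (S : Set (PG F)) : Set (PG F) :=
  {l | Even {p ∈ S | Incid p l}.ncard}

/-- `f(r)`: the minimum size of the symmetric difference of `r` distinct lines,
i.e. the minimum of `|𝒫ᵒ(R)|` over sets `R` of exactly `r` lines. -/
noncomputable def fmin (F : Type*) [Field F] (r : ℕ) : ℕ :=
  sInf {n | ∃ R : Set (PG F), R.ncard = r ∧ (Podd F R).ncard = n}

theorem incid_iff {F : Type*} [Field F] (p l : PG F) :
    Incid p l ↔ Projectivization.orthogonal p l := by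
  conv_rhs => rw [← p.mk_rep, ← l.mk_rep]
  rw [Projectivization.orthogonal_mk]
  rfl

theorem incid_comm {F : Type*} [Field F] (p l : PG F) : Incid p l ↔ Incid l p := by
  rw [incid_iff, incid_iff, Projectivization.orthogonal_comm]

open Classical in
theorem ncard_cast {α : Type*} [Fintype α] (S : Set α) :
    (S.ncard : ZMod 2) = ∑ p, if p ∈ S then (1 : ZMod 2) else 0 := by
  rw [Finset.sum_boole, Set.ncard_eq_toFinset_card']
  congr 2
  ext x
  simp

open Classical in
theorem even_line {F : Type*} [Field F] [Fintype F] [Fintype (PG F)]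
    (hq : Odd (Fintype.card F)) (l : PG F) :
    (∑ p : PG F, if Incid p l then (1 : ZMod 2) else 0) = 0 := by
  have h1 := Configuration.ProjectivePlane.pointCount_eq (P := PG F) (L := PG F) l
  have h2 := Configuration.ProjectivePlane.card_points (PG F) (PG F)
  have h3 := Projectivization.card_of_finrank F (Fin 3 → F) (n := 3) (by simp)
  rw [Nat.card_eq_fintype_card, h2, Nat.card_eq_fintype_card] at h3
  simp only [Finset.sum_range_succ, Finset.sum_range_zero, pow_zero, pow_one, zero_add] at h3
  have h4 : Configuration.ProjectivePlane.order (PG F) (PG F) = Fintype.card F := by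
    rcases lt_trichotomy (Configuration.ProjectivePlane.order (PG F) (PG F))
      (Fintype.card F) with h | h | h
    · nlinarith
    · exact h
    · nlinarith
  have h5 : ({p : PG F | Incid p l}.ncard : ZMod 2) = 0 := by
    have : {p : PG F | Incid p l}.ncard = Fintype.card F + 1 := by
      rw [← h4, ← h1, Configuration.pointCount, ← Nat.card_coe_set_eq]
      apply Nat.card_congr
      exact Equiv.subtypeEquivRight (fun p => incid_iff p l)
    rw [this, ZMod.natCast_eq_zero_iff_even]
    exact hq.add_one
  rw [ncard_cast] at h5
  simpa using h5

open Classical in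
theorem two_lines {F : Type*} [Field F] [Fintype F] [Fintype (PG F)]
    (k l : PG F) (h : k ≠ l) :
    (∑ p : PG F, if Incid k p ∧ Incid p l then (1 : ZMod 2) else 0) = 1 := by
  rw [Finset.sum_eq_single (Projectivization.cross k l)]
  · rw [if_pos]
    rw [incid_iff, incid_iff]
    exact ⟨Projectivization.orthogonal_cross_left h, Projectivization.cross_orthogonal_right h⟩
  · intro b _ hb
    rw [if_neg]
    rintro ⟨h1, h2⟩
    rw [incid_comm, incid_iff] at h1
    rw [incid_iff] at h2
    rcases Configuration.ofField.eq_or_eq_of_orthogonal h1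
      (Projectivization.cross_orthogonal_left h) h2
      (Projectivization.cross_orthogonal_right h) with h3 | h3
    · exact hb h3
    · exact h h3
  · simp

open Classical in
theorem mem_Podd_cast {F : Type*} [Field F] [Fintype F] [Fintype (PG F)]
    (R : Set (PG F)) (p : PG F) :
    (if p ∈ Podd F R then (1 : ZMod 2) else 0) =
      ∑ l, (if Incid p l then (1 : ZMod 2) else 0) * (if l ∈ R then 1 else 0) := by
  have h : ({l ∈ R | Incid p l}.ncard : ZMod 2) =
      ∑ l, (if Incid p l then (1 : ZMod 2) else 0) * (if l ∈ R then 1 else 0) := by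
    rw [ncard_cast]
    apply Finset.sum_congr rfl
    intro l _
    by_cases h1 : Incid p l <;> by_cases h2 : l ∈ R <;> simp [h1, h2]
  rw [← h]
  by_cases hp : p ∈ Podd F R
  · rw [if_pos hp]
    exact ((ZMod.natCast_eq_one_iff_odd).2 hp).symm
  · rw [if_neg hp]
    exact ((ZMod.natCast_eq_zero_iff_even).2 (Nat.not_odd_iff_even.1 hp)).symm

theorem Podd_even {F : Type*} [Field F] [Fintype F] (hq : Odd (Fintype.card F))
    (R : Set (PG F)) : Even (Podd F R).ncard := by
  classical
  have : Fintype (PG F) := Fintype.ofFinite _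
  rw [← ZMod.natCast_eq_zero_iff_even, ncard_cast]
  simp_rw [mem_Podd_cast]
  rw [Finset.sum_comm]
  apply Finset.sum_eq_zero
  intro l _
  rw [← Finset.sum_mul, even_line hq, zero_mul]

theorem Podd_Podd {F : Type*} [Field F] [Fintype F] (hq : Odd (Fintype.card F))
    (R : Set (PG F)) (hR : Even R.ncard) : Podd F (Podd F R) = R := by
  classical
  have : Fintype (PG F) := Fintype.ofFinite _
  rw [← ZMod.natCast_eq_zero_iff_even, ncard_cast] at hR
  have key : ∀ k : PG F, (if k ∈ Podd F (Podd F R) then (1 : ZMod 2) else 0) =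
      if k ∈ R then 1 else 0 := by
    intro k
    rw [mem_Podd_cast]
    simp_rw [mem_Podd_cast, Finset.mul_sum]
    rw [Finset.sum_comm]
    have h1 : ∀ l : PG F, (∑ p : PG F, (if Incid k p then (1 : ZMod 2) else 0) *
        ((if Incid p l then (1 : ZMod 2) else 0) * (if l ∈ R then 1 else 0))) =
        (if l ∈ R then 1 else 0) - if l = k then (if k ∈ R then 1 else 0) else 0 := by
      intro l
      simp_rw [← mul_assoc]
      rw [← Finset.sum_mul]
      by_cases h : l = k
      · subst h
        have h2 := even_line hq l
        have h3 : (∑ p : PG F, (if Incid l p then (1 : ZMod 2) else 0) *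
            (if Incid p l then (1 : ZMod 2) else 0)) = 0 := by
          refine Eq.trans ?_ h2
          apply Finset.sum_congr rfl
          intro p _
          by_cases h4 : Incid p l <;> simp [h4, incid_comm l p]
        rw [h3]
        simp
      · have h2 := two_lines k l (Ne.symm h)
        have h3 : (∑ p : PG F, (if Incid k p then (1 : ZMod 2) else 0) *
            (if Incid p l then (1 : ZMod 2) else 0)) = 1 := by
          refine Eq.trans ?_ h2
          apply Finset.sum_congr rfl
          intro p _
          by_cases h4 : Incid p l <;> by_cases h5 : Incid k p <;> simp [h4, h5]
        rw [h3]
        simp [h]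
    rw [Finset.sum_congr rfl (fun l _ => h1 l), Finset.sum_sub_distrib, hR,
      Finset.sum_ite_eq' Finset.univ k, if_pos (Finset.mem_univ k), zero_sub]
    exact ZMod.neg_eq_self_mod_two _
  ext k
  have := key k
  by_cases h1 : k ∈ Podd F (Podd F R) <;> by_cases h2 : k ∈ R <;> simp_all

/-- For even `s`, `f(s)` is the minimum even `r` for which there exists a set
`R` of `r` lines with `|𝒫ᵒ(R)| = s`. -/
theorem stmt7 {F : Type*} [Field F] [Fintype F] (q : ℕ)
    (hcard : Fintype.card F = q) (hq : Odd q)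
    (s : ℕ) (hs : Even s) (hsN : s ≤ q ^ 2 + q + 1) :
    fmin F s =
      sInf {r | Even r ∧ ∃ R : Set (PG F), R.ncard = r ∧ (Podd F R).ncard = s} := by
  subst hcard
  unfold fmin
  congr 1
  ext r
  constructor
  · rintro ⟨R, h1, h2⟩
    refine ⟨h2 ▸ Podd_even hq R, Podd F R, h2, ?_⟩
    rw [Podd_Podd hq R (h1 ▸ hs), h1]
  · rintro ⟨hr, R, h1, h2⟩
    exact ⟨Podd F R, h2, by rw [Podd_Podd hq R (h1 ▸ hr), h1]⟩
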